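/- arXiv:math/0203295 — 2 statements merged into one kernel-verified Lean document; each statement's English description precedes it below -/
import Mathlib

section
/- Let G be a finite group with subgroups H₁ and H₂ such that each conjugacy class of G intersects H₁ and H₂ in the same number of elements. Let k be a field of characteristic zero, V a finite-dimensional k-linear representation of G, and Δ a k-linear endomorphism of V commuting with the action of G. Then the trace of the restriction of Δ to the invariant subspace V^{H₁} equals the trace of the restriction of Δ to V^{H₂}. -/
/-- The Gassmann condition: each conjugacy class of `G` intersects `H₁` and `H₂`
in the same number of elements. -/
def Gassmann {G : Type*} [Group G] (H₁ H₂ : Subgroup G) : Prop :=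
  ∀ g : G, Nat.card {x : G // IsConj g x ∧ x ∈ H₁} =
    Nat.card {x : G // IsConj g x ∧ x ∈ H₂}

/-- The submodule of `H`-invariants of a representation `ρ` of `G`, for `H ≤ G`. -/
def repInvariants {k G V : Type*} [CommRing k] [Group G] [AddCommGroup V] [Module k V]
    (ρ : Representation k G V) (H : Subgroup G) : Submodule k V where
  carrier := {v | ∀ h ∈ H, ρ h v = v}
  add_mem' := by intro a b ha hb h hh; simp [map_add, ha h hh, hb h hh]
  zero_mem' := by intro h hh; simp
  smul_mem' := by intro c v hv h hh; simp [map_smul, hv h hh]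

/-- Gassmann-equivalent subgroups of a finite group admit a bijection preserving conjugacy
classes of the ambient group. -/
theorem Gassmann.exists_equiv_isConj {G : Type*} [Group G] [Finite G] {H₁ H₂ : Subgroup G}
    (hG : Gassmann H₁ H₂) : ∃ e : H₁ ≃ H₂, ∀ h : H₁, IsConj (h : G) (e h : G) := by
  have fiberEquiv (H : Subgroup G) (g : G) :
      Nonempty ({h : H // ConjClasses.mk (h : G) = ConjClasses.mk g} ≃
        {x : G // IsConj g x ∧ x ∈ H}) :=
    ⟨{ toFun := fun h => ⟨h.1, (ConjClasses.mk_eq_mk_iff_isConj.1 h.2).symm, h.1.2⟩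
       invFun := fun x => ⟨⟨x.1, x.2.2⟩, ConjClasses.mk_eq_mk_iff_isConj.2 x.2.1.symm⟩
       left_inv := fun _ => rfl
       right_inv := fun _ => rfl }⟩
  have fibers (c : ConjClasses G) :
      Nonempty ({h : H₁ // ConjClasses.mk (h : G) = c} ≃
        {h : H₂ // ConjClasses.mk (h : G) = c}) := by
    obtain ⟨g, rfl⟩ := ConjClasses.exists_rep c
    obtain ⟨e₁⟩ := fiberEquiv H₁ g
    obtain ⟨e₂⟩ := fiberEquiv H₂ g
    exact ⟨((e₁.trans (Finite.equivFinOfCardEq (hG g))).trans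
      (Finite.equivFin _).symm).trans e₂.symm⟩
  refine ⟨Equiv.ofFiberEquiv fun c => (fibers c).some, fun h => ?_⟩
  exact ConjClasses.mk_eq_mk_iff_isConj.1
    (Equiv.ofFiberEquiv_map (fun c => (fibers c).some) h).symm

/-- The trace on `H`-invariants of an endomorphism preserving them, scaled by the order of `H`,
is a sum of traces on the whole representation. -/
theorem card_mul_trace_restrict_repInvariants {k G V : Type*} [Field k] [Group G]
    [AddCommGroup V] [Module k V] [FiniteDimensional k V] (ρ : Representation k G V)
    (H : Subgroup G) [Fintype H] (Δ : V →ₗ[k] V)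
    (hΔ : ∀ v ∈ repInvariants ρ H, Δ v ∈ repInvariants ρ H) :
    (Fintype.card H : k) * LinearMap.trace k (repInvariants ρ H) (Δ.restrict hΔ) =
      ∑ h : H, LinearMap.trace k V (Δ ∘ₗ ρ h) := by
  have sum_mem (v : V) : (∑ h : H, ρ h) v ∈ repInvariants ρ H := by
    intro g hg
    simp only [LinearMap.sum_apply, map_sum]
    refine Fintype.sum_equiv (Equiv.mulLeft (⟨g, hg⟩ : H)) _ _ fun h => ?_
    simp
  let S : V →ₗ[k] repInvariants ρ H := (∑ h : H, ρ h).codRestrict _ sum_mem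
  have restrict_eq : (Fintype.card H : k) • Δ.restrict hΔ =
      S ∘ₗ (Δ ∘ₗ (repInvariants ρ H).subtype) := by
    ext v
    have fixed (h : H) : ρ h (Δ v) = Δ v := hΔ v v.2 h h.2
    simp [S, fixed, Nat.cast_smul_eq_nsmul]
  have comp_eq : (Δ ∘ₗ (repInvariants ρ H).subtype) ∘ₗ S = ∑ h : H, Δ ∘ₗ ρ h := by
    ext v
    simp [S, LinearMap.sum_apply]
  rw [← smul_eq_mul, ← map_smul, restrict_eq, LinearMap.trace_comp_comm', comp_eq, map_sum]

/-- If `Δ` commutes with `G`, then `g ↦ tr (Δ ∘ ρ g)` is a class function. -/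
theorem trace_comp_eq_of_isConj {k G V : Type*} [Field k] [Group G]
    [AddCommGroup V] [Module k V] (ρ : Representation k G V) (Δ : V →ₗ[k] V)
    (hΔ : ∀ g : G, Δ ∘ₗ ρ g = ρ g ∘ₗ Δ) {x y : G} (hxy : IsConj x y) :
    LinearMap.trace k V (Δ ∘ₗ ρ x) = LinearMap.trace k V (Δ ∘ₗ ρ y) := by
  obtain ⟨c, rfl⟩ := isConj_iff.1 hxy
  have comm : Δ * ρ c = ρ c * Δ := hΔ c
  change LinearMap.trace k V (Δ * ρ x) = LinearMap.trace k V (Δ * ρ (c * x * c⁻¹))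
  have conj_eq : Δ * ρ (c * x * c⁻¹) = ρ c * (Δ * ρ (x * c⁻¹)) := by
    rw [mul_assoc c, map_mul ρ c, ← mul_assoc, comm, mul_assoc]
  rw [conj_eq, LinearMap.trace_mul_comm k (ρ c), mul_assoc, ← map_mul ρ, inv_mul_cancel_right]

theorem stmt11 {k G V : Type*} [Field k] [CharZero k] [Group G] [Finite G]
    [AddCommGroup V] [Module k V] [FiniteDimensional k V]
    (ρ : Representation k G V) (H₁ H₂ : Subgroup G) (hG : Gassmann H₁ H₂)
    (Δ : V →ₗ[k] V) (hΔ : ∀ g : G, Δ ∘ₗ ρ g = ρ g ∘ₗ Δ)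
    (h₁ : ∀ v ∈ repInvariants ρ H₁, Δ v ∈ repInvariants ρ H₁)
    (h₂ : ∀ v ∈ repInvariants ρ H₂, Δ v ∈ repInvariants ρ H₂) :
    LinearMap.trace k (repInvariants ρ H₁) (Δ.restrict h₁) =
      LinearMap.trace k (repInvariants ρ H₂) (Δ.restrict h₂) := by
  have := Fintype.ofFinite H₁
  have := Fintype.ofFinite H₂
  obtain ⟨e, he⟩ := hG.exists_equiv_isConj
  have card_ne : (Fintype.card H₁ : k) ≠ 0 := Nat.cast_ne_zero.2 Fintype.card_ne_zero
  refine mul_left_cancel₀ card_ne ?_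
  rw [card_mul_trace_restrict_repInvariants, Fintype.card_congr e,
    card_mul_trace_restrict_repInvariants]
  exact Fintype.sum_equiv e _ _ fun h => trace_comp_eq_of_isConj ρ Δ hΔ (he h)
end

section
/- Let G be a finite group with subgroups H₁ and H₂ such that each conjugacy class of G intersects H₁ and H₂ in the same number of elements. Let X be a set with a G-action, k a field of characteristic zero, and let V = (X → k) carry the G-action (g·f)(x) = f(g⁻¹·x). Suppose Δ is a k-linear endomorphism of V commuting with the G-action. Then there exists a k-linear isomorphism between the space of functions on the orbit space X/H₁ with values in k and the space of functions on X/H₂ with values in k which intertwines the operators induced by Δ on these spaces (under the identification of functions on X/Hᵢ with Hᵢ-invariant functions on X). -/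
/-- The representation of `G` on `k`-valued functions on a `G`-set `X`,
given by `(g • f) x = f (g⁻¹ • x)`. -/
def permRep (k G X : Type*) [CommRing k] [Group G] [MulAction G X] :
    Representation k G (X → k) where
  toFun g :=
    { toFun := fun f x => f (g⁻¹ • x)
      map_add' := fun _ _ => rfl
      map_smul' := fun _ _ => rfl }
  map_one' := by ext f x; simp
  map_mul' g₁ g₂ := by ext f x; simp [mul_smul]

universe u

open Module MonoidAlgebra

/-- Over a semisimple algebra, a finite-dimensional module is determined up to isomorphism by the
dimensions of the spaces of homomorphisms out of it. -/
theorem nonempty_linearEquiv_of_finrank_hom_eq {k : Type*} {A : Type*} [Field k] [Ring A]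
    [Algebra k A] [IsSemisimpleRing A] {M N : Type u} [AddCommGroup M] [Module A M] [Module k M]
    [IsScalarTower k A M] [Module.Finite k M] [AddCommGroup N] [Module A N] [Module k N]
    [IsScalarTower k A N] [Module.Finite k N]
    (h : ∀ (W : Type u) [AddCommGroup W] [Module A W] [Module k W] [IsScalarTower k A W]
      [Module.Finite k W], finrank k (M →ₗ[A] W) = finrank k (N →ₗ[A] W)) :
    Nonempty (M ≃ₗ[A] N) := by
  have hfin : ∀ (P Q : Type u) [AddCommGroup P] [Module A P] [Module k P] [IsScalarTower k A P]
      [Module.Finite k P] [AddCommGroup Q] [Module A Q] [Module k Q] [IsScalarTower k A Q]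
      [Module.Finite k Q], Module.Finite k (P →ₗ[A] Q) := fun P Q => by
    intros
    exact Module.Finite.of_injective (LinearMap.restrictScalarsₗ k A P Q k)
      (LinearMap.restrictScalars_injective k)
  have hprod : ∀ (P Q R W : Type u) [AddCommGroup P] [Module A P] [Module k P]
      [IsScalarTower k A P] [Module.Finite k P] [AddCommGroup Q] [Module A Q] [Module k Q]
      [IsScalarTower k A Q] [Module.Finite k Q] [AddCommGroup R] [Module A R]
      [AddCommGroup W] [Module A W] [Module k W] [IsScalarTower k A W] [Module.Finite k W],
      ((P × Q) ≃ₗ[A] R) →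
      finrank k (R →ₗ[A] W) = finrank k (P →ₗ[A] W) + finrank k (Q →ₗ[A] W) := by
    intro P Q R W _ _ _ _ _ _ _ _ _ _ _ _ _ _ _ _ _ e
    have := hfin P W
    have := hfin Q W
    rw [← finrank_prod]
    exact ((e.congrLeft W k).symm.trans (LinearMap.coprodEquiv k).symm).finrank_eq
  induction hn : finrank k M using Nat.strong_induction_on generalizing M N with
  | _ n ih =>
  subst hn
  rcases subsingleton_or_nontrivial M with hM | of
  · have h0 : finrank k (N →ₗ[A] N) = 0 := by
      rw [← h N]
      exact finrank_zero_of_subsingleton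
    have := hfin N N
    have := finrank_zero_iff.mp h0
    have : Subsingleton N := subsingleton_of_forall_eq 0 fun x =>
      congrArg (fun f : N →ₗ[A] N => f x) (Subsingleton.elim LinearMap.id 0)
    exact ⟨0⟩
  · obtain ⟨S, hS⟩ := IsSemisimpleModule.exists_simple_submodule A M
    obtain ⟨M', hM'⟩ := exists_isCompl S
    have hSn := IsSimpleModule.nontrivial A S
    have : Module.Finite k S := inferInstanceAs (Module.Finite k (S.restrictScalars k))
    have : Module.Finite k M' := inferInstanceAs (Module.Finite k (M'.restrictScalars k))
    have eM := S.prodEquivOfIsCompl M' hM'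
    have hpos : 0 < finrank k (N →ₗ[A] S) := by
      have := hfin S S
      rw [← h S, hprod S M' M S eM]
      have : Nontrivial (S →ₗ[A] S) := inferInstanceAs (Nontrivial (Module.End A S))
      have := finrank_pos (R := k) (M := S →ₗ[A] S)
      omega
    have := nontrivial_of_finrank_pos hpos
    obtain ⟨f, hf⟩ := exists_ne (0 : N →ₗ[A] S)
    have hfs := LinearMap.surjective_of_ne_zero hf
    obtain ⟨C, hC⟩ := exists_isCompl (LinearMap.ker f)
    have eC : C ≃ₗ[A] S := (Submodule.quotientEquivOfIsCompl _ C hC).symm.trans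
      (f.quotKerEquivOfSurjective hfs)
    let N' := LinearMap.ker f
    have : Module.Finite k N' := inferInstanceAs (Module.Finite k (N'.restrictScalars k))
    have eN : (S × N') ≃ₗ[A] N := ((eC.symm.prodCongr (LinearEquiv.refl A N')).trans
      (LinearEquiv.prodComm A C N')).trans (Submodule.prodEquivOfIsCompl N' C hC)
    have hlt : finrank k M' < finrank k M := by
      rw [← (eM.restrictScalars k).finrank_eq, finrank_prod]
      have := finrank_pos (R := k) (M := S)
      omega
    obtain ⟨e⟩ := ih _ hlt (M := M') (N := N') (fun W => by
      intros
      have h1 := h W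
      rw [hprod S M' M W eM, hprod S N' N W eN] at h1
      omega) rfl
    exact ⟨eM.symm.trans (((LinearEquiv.refl A S).prodCongr e).trans eN)⟩

/-- The homomorphisms out of the left ideal generated by an idempotent `e` into `W`
have the dimension of `e W`. -/
theorem finrank_hom_span_idempotent {k A W : Type*} [Field k] [Ring A] [Algebra k A]
    [AddCommGroup W] [Module A W] [Module k W] [IsScalarTower k A W] {e : A}
    (he : IsIdempotentElem e) :
    finrank k (Ideal.span {e} →ₗ[A] W) =
      finrank k (LinearMap.range (Algebra.lsmul k k W e)) := by
  have hmem : e ∈ Ideal.span {e} := Ideal.mem_span_singleton_self e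
  let ev : (Ideal.span {e} →ₗ[A] W) →ₗ[k] W :=
    { toFun := fun f => f ⟨e, hmem⟩
      map_add' := fun _ _ => rfl
      map_smul' := fun _ _ => rfl }
  have hinj : Function.Injective ev := by
    intro f g hfg
    ext ⟨x, hx⟩
    obtain ⟨a, rfl⟩ := Ideal.mem_span_singleton'.mp hx
    have : (⟨a * e, hx⟩ : Ideal.span {e}) = a • ⟨e, hmem⟩ := rfl
    rw [this, map_smul, map_smul]
    exact congrArg (a • ·) hfg
  have hrange : LinearMap.range ev = LinearMap.range (Algebra.lsmul k k W e) := by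
    apply le_antisymm
    · rintro _ ⟨f, rfl⟩
      refine ⟨f ⟨e, hmem⟩, ?_⟩
      change e • f ⟨e, hmem⟩ = f ⟨e, hmem⟩
      rw [← map_smul]
      exact congrArg f (Subtype.ext he)
    · rintro _ ⟨w, rfl⟩
      exact ⟨(LinearMap.toSpanSingleton A W w).comp (Submodule.subtype _), rfl⟩
  rw [← hrange, LinearMap.finrank_range_of_inj hinj]

/-- In a finite-dimensional semisimple algebra over a field of characteristic zero, two idempotents
with the same trace on every finite-dimensional module are equivalent. -/
theorem exists_mul_eq_of_trace_eq {k : Type*} {A : Type u} [Field k] [CharZero k] [Ring A]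
    [Algebra k A] [IsSemisimpleRing A] [Module.Finite k A] {e f : A}
    (he : IsIdempotentElem e) (hf : IsIdempotentElem f)
    (h : ∀ (W : Type u) [AddCommGroup W] [Module A W] [Module k W] [IsScalarTower k A W]
      [Module.Finite k W], LinearMap.trace k W (Algebra.lsmul k k W e) =
        LinearMap.trace k W (Algebra.lsmul k k W f)) :
    ∃ a b : A, a * b = e ∧ b * a = f ∧ e * a = a ∧ f * b = b := by
  have hfin (I : Ideal A) : Module.Finite k I :=
    inferInstanceAs (Module.Finite k (Submodule.restrictScalars k I))
  obtain ⟨φ⟩ := nonempty_linearEquiv_of_finrank_hom_eq (k := k) (A := A)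
    (M := Ideal.span {e}) (N := Ideal.span {f}) (fun W => by
      intros
      rw [finrank_hom_span_idempotent he, finrank_hom_span_idempotent hf]
      have h1 := h W
      rw [(LinearMap.IsIdempotentElem.isProj_range _ (he.map (Algebra.lsmul k k W))).trace,
        (LinearMap.IsIdempotentElem.isProj_range _ (hf.map (Algebra.lsmul k k W))).trace] at h1
      exact_mod_cast h1)
  have hmul {g x : A} (hg : IsIdempotentElem g) (hx : x ∈ Ideal.span {g}) : x * g = x := by
    obtain ⟨a, rfl⟩ := Ideal.mem_span_singleton'.mp hx
    rw [mul_assoc, hg.eq]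
  let e' : Ideal.span {e} := ⟨e, Ideal.mem_span_singleton_self e⟩
  let f' : Ideal.span {f} := ⟨f, Ideal.mem_span_singleton_self f⟩
  have hee : e • e' = e' := Subtype.ext he
  have hff : f • f' = f' := Subtype.ext hf
  have hae : (φ e' : A) • f' = φ e' := Subtype.ext (hmul hf (φ e').2)
  have hbf : (φ.symm f' : A) • e' = φ.symm f' := Subtype.ext (hmul he (φ.symm f').2)
  refine ⟨φ e', φ.symm f', ?_, ?_, ?_, ?_⟩
  · have := congrArg φ.symm hae
    rw [map_smul, φ.symm_apply_apply] at this
    exact congrArg Subtype.val this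
  · have := congrArg φ hbf
    rw [map_smul, φ.apply_symm_apply] at this
    exact congrArg Subtype.val this
  · have := congrArg φ hee
    rw [map_smul] at this
    exact congrArg Subtype.val this
  · have := congrArg φ.symm hff
    rw [map_smul] at this
    exact congrArg Subtype.val this

/-- Subgroups satisfying the Gassmann condition are in bijection by a map preserving conjugacy
classes of the ambient group. -/
theorem Gassmann.exists_equiv {G : Type*} [Group G] [Finite G] {H₁ H₂ : Subgroup G}
    (hG : Gassmann H₁ H₂) : ∃ σ : H₁ ≃ H₂, ∀ h : H₁, IsConj (h : G) (σ h : G) := by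
  have key (c : ConjClasses G) : Nonempty ({h : H₁ // ConjClasses.mk (h : G) = c} ≃
      {h : H₂ // ConjClasses.mk (h : G) = c}) := by
    obtain ⟨g, rfl⟩ := ConjClasses.mk_surjective c
    have fiber (H : Subgroup G) : {h : H // ConjClasses.mk (h : G) = ConjClasses.mk g} ≃
        {x : G // IsConj g x ∧ x ∈ H} :=
      { toFun := fun h => ⟨h.1, (ConjClasses.mk_eq_mk_iff_isConj.mp h.2).symm, h.1.2⟩
        invFun := fun x => ⟨⟨x.1, x.2.2⟩, ConjClasses.mk_eq_mk_iff_isConj.mpr x.2.1.symm⟩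
        left_inv := fun _ => rfl
        right_inv := fun _ => rfl }
    exact ⟨(fiber H₁).trans ((Finite.card_eq.mp (hG g)).some.trans (fiber H₂).symm)⟩
  let σ := fun c => (key c).some
  let τ : H₁ ≃ H₂ := Equiv.ofFiberEquiv (f := fun h : H₁ => ConjClasses.mk (h : G))
    (g := fun h : H₂ => ConjClasses.mk (h : G)) σ
  exact ⟨τ, fun h => ConjClasses.mk_eq_mk_iff_isConj.mp
    (Equiv.ofFiberEquiv_map (g := fun h : H₂ => ConjClasses.mk (h : G)) σ h).symm⟩

/-- The average of the elements of a subgroup, in the group algebra. -/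
noncomputable def subgroupAverage (k : Type*) {G : Type*} [Field k] [Group G] (H : Subgroup G)
    [Fintype H] : MonoidAlgebra k G :=
  (Fintype.card H : k)⁻¹ • ∑ h : H, of k G h

theorem of_mul_subgroupAverage {k G : Type*} [Field k] [Group G] (H : Subgroup G)
    [Fintype H] (h : H) : of k G h * subgroupAverage k H = subgroupAverage k H := by
  rw [subgroupAverage, mul_smul_comm, Finset.mul_sum]
  congr 1
  exact Fintype.sum_equiv (Equiv.mulLeft h) _ _ fun x => by simp

theorem isIdempotentElem_subgroupAverage {k G : Type*} [Field k] [CharZero k] [Group G]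
    (H : Subgroup G) [Fintype H] : IsIdempotentElem (subgroupAverage k H) := by
  have hc : (Fintype.card H : k) ≠ 0 := Nat.cast_ne_zero.mpr Fintype.card_ne_zero
  unfold IsIdempotentElem
  conv_lhs => enter [1]; rw [subgroupAverage]
  rw [smul_mul_assoc, Finset.sum_mul]
  simp_rw [of_mul_subgroupAverage]
  rw [Finset.sum_const, Finset.card_univ, ← Nat.cast_smul_eq_nsmul k, smul_smul,
    inv_mul_cancel₀ hc, one_smul]

theorem Gassmann.trace_subgroupAverage {k G W : Type*} [Field k] [Group G] [Finite G]
    {H₁ H₂ : Subgroup G} [Fintype H₁] [Fintype H₂] (hG : Gassmann H₁ H₂) [AddCommGroup W]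
    [Module (MonoidAlgebra k G) W] [Module k W] [IsScalarTower k (MonoidAlgebra k G) W] :
    LinearMap.trace k W (Algebra.lsmul k k W (subgroupAverage k H₁)) =
      LinearMap.trace k W (Algebra.lsmul k k W (subgroupAverage k H₂)) := by
  obtain ⟨σ, hσ⟩ := hG.exists_equiv
  simp only [subgroupAverage, map_smul, map_sum, Fintype.card_congr σ]
  congr 1
  refine Fintype.sum_equiv σ _ _ fun h => ?_
  obtain ⟨c, hc⟩ := isConj_iff.mp (hσ h)
  rw [← hc, map_mul (of k G), map_mul (Algebra.lsmul k k W), LinearMap.trace_mul_comm,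
    ← map_mul (Algebra.lsmul k k W), ← map_mul (of k G), inv_mul_cancel_left]

/-- Pullback of functions along the orbit map `X → X/H`. -/
def orbitPullback (k X : Type*) {G : Type*} [Field k] [Group G] [MulAction G X] (H : Subgroup G) :
    (MulAction.orbitRel.Quotient H X → k) →ₗ[k] (X → k) :=
  LinearMap.funLeft k k (Quotient.mk (MulAction.orbitRel H X))

theorem orbitPullback_injective (k X : Type*) {G : Type*} [Field k] [Group G] [MulAction G X]
    (H : Subgroup G) : Function.Injective (orbitPullback k X H) :=
  LinearMap.funLeft_injective_of_surjective k k _ Quotient.mk_surjective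

theorem range_orbitPullback {k G : Type*} (X : Type*) [Field k] [CharZero k] [Group G]
    [MulAction G X] (H : Subgroup G) [Fintype H] :
    LinearMap.range (orbitPullback k X H) =
      LinearMap.range ((permRep k G X).asAlgebraHom (subgroupAverage k H)) := by
  have hc : (Fintype.card H : k) ≠ 0 := Nat.cast_ne_zero.mpr Fintype.card_ne_zero
  apply le_antisymm
  · rintro _ ⟨F, rfl⟩
    refine ⟨orbitPullback k X H F, ?_⟩
    have (h : H) : permRep k G X h (orbitPullback k X H F) = orbitPullback k X H F := by
      ext x
      exact congrArg F (Quotient.sound ⟨h⁻¹, rfl⟩)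
    simp only [subgroupAverage, map_smul, map_sum, Representation.asAlgebraHom_of,
      LinearMap.smul_apply, LinearMap.sum_apply, this]
    rw [Finset.sum_const, Finset.card_univ, ← Nat.cast_smul_eq_nsmul k, smul_smul,
      inv_mul_cancel₀ hc, one_smul]
  · rintro _ ⟨f, rfl⟩
    refine ⟨Quotient.lift ((permRep k G X).asAlgebraHom (subgroupAverage k H) f) ?_, rfl⟩
    rintro _ y ⟨h, rfl⟩
    have := congrArg (fun a => (permRep k G X).asAlgebraHom a f y)
      (of_mul_subgroupAverage (k := k) H h⁻¹)
    rw [map_mul, Representation.asAlgebraHom_of] at this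
    simpa [permRep, Subgroup.smul_def] using this

theorem stmt15 {k G X : Type*} [Field k] [CharZero k] [Group G] [Finite G] [MulAction G X]
    (H₁ H₂ : Subgroup G) (hG : Gassmann H₁ H₂)
    (Δ : (X → k) →ₗ[k] (X → k))
    (hΔ : ∀ g : G, Δ ∘ₗ permRep k G X g = permRep k G X g ∘ₗ Δ) :
    ∃ e : (MulAction.orbitRel.Quotient H₁ X → k) ≃ₗ[k]
        (MulAction.orbitRel.Quotient H₂ X → k),
      ∀ (F F' : MulAction.orbitRel.Quotient H₁ X → k)
        (F'' : MulAction.orbitRel.Quotient H₂ X → k),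
        Δ (fun x => F (Quotient.mk (MulAction.orbitRel H₁ X) x)) =
          (fun x => F' (Quotient.mk (MulAction.orbitRel H₁ X) x)) →
        Δ (fun x => e F (Quotient.mk (MulAction.orbitRel H₂ X) x)) =
          (fun x => F'' (Quotient.mk (MulAction.orbitRel H₂ X) x)) →
        e F' = F'' := by
  have := Fintype.ofFinite H₁
  have := Fintype.ofFinite H₂
  have : NeZero (Nat.card G : k) := ⟨Nat.cast_ne_zero.mpr Nat.card_pos.ne'⟩
  obtain ⟨a, b, hab, hba, ha, hb⟩ := exists_mul_eq_of_trace_eq (k := k)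
    (isIdempotentElem_subgroupAverage (k := k) H₁) (isIdempotentElem_subgroupAverage (k := k) H₂)
    (fun W => by intros; exact hG.trace_subgroupAverage)
  let ρ := (permRep k G X).asAlgebraHom
  have hcomm (c : MonoidAlgebra k G) : Commute Δ (ρ c) := by
    induction c using MonoidAlgebra.induction_on with
    | of g => rw [Representation.asAlgebraHom_of]; exact hΔ g
    | add x y hx hy => rw [map_add]; exact hx.add_right hy
    | smul r x hx => rw [map_smul]; exact hx.smul_right r
  have lift (H : Subgroup G) [Fintype H] (c : MonoidAlgebra k G)
      (hc : subgroupAverage k H * c = c) (f : X → k) : ∃ F, orbitPullback k X H F = ρ c f := by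
    rw [← LinearMap.mem_range, range_orbitPullback, ← hc, map_mul]
    exact ⟨_, rfl⟩
  have fixed (H : Subgroup G) [Fintype H] (F : MulAction.orbitRel.Quotient H X → k) :
      ρ (subgroupAverage k H) (orbitPullback k X H F) = orbitPullback k X H F := by
    have : orbitPullback k X H F ∈ LinearMap.range (ρ (subgroupAverage k H)) := by
      rw [← range_orbitPullback]; exact ⟨F, rfl⟩
    obtain ⟨f, hf⟩ := this
    rw [← hf, ← Module.End.mul_apply, ← map_mul, (isIdempotentElem_subgroupAverage H).eq]
  choose T hT using fun F => lift H₂ b hb (orbitPullback k X H₁ F)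
  choose S hS using fun F => lift H₁ a ha (orbitPullback k X H₂ F)
  have hinj₁ := orbitPullback_injective k X H₁
  have hinj₂ := orbitPullback_injective k X H₂
  refine ⟨{ toFun := T, invFun := S, map_add' := fun F F' => hinj₂ ?_,
            map_smul' := fun r F => hinj₂ ?_, left_inv := fun F => hinj₁ ?_,
            right_inv := fun F => hinj₂ ?_ }, fun F F' F'' h₁ h₂ => hinj₂ ?_⟩
  · simp only [map_add, hT]
  · simp only [map_smul, hT, RingHom.id_apply]
  · rw [hS, hT, ← Module.End.mul_apply, ← map_mul, hab, fixed]
  · rw [hT, hS, ← Module.End.mul_apply, ← map_mul, hba, fixed]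
  · change Δ (orbitPullback k X H₁ F) = orbitPullback k X H₁ F' at h₁
    change Δ (orbitPullback k X H₂ (T F)) = orbitPullback k X H₂ F'' at h₂
    change orbitPullback k X H₂ (T F') = _
    rw [hT, ← h₁, ← h₂, hT]
    exact (LinearMap.congr_fun (hcomm b).eq _).symm
end
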